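/- arXiv:2011.08522 — 8 statements merged into one kernel-verified Lean document; each statement's English description precedes it below -/
import Mathlib

section
/- Let t, t' ∈ B_n with t ≠ t', and let G be a digraph such that the graph algebra A(G) satisfies the identity t ≈ t'. Then every outlet in G has length at most Y_{t,t'} + 1; in other words, O_G ≤ Y_{t,t'} + 1. -/
open Classical

/-- Bracketings of size `n`: binary terms in which `x_1, …, x_n` occur
exactly once, in this order. -/
inductive Bracketing : ℕ → Type
  | leaf : Bracketing 1
  | node : {m k : ℕ} → Bracketing m → Bracketing k → Bracketing (m + k)

/-- The `n`-ary term operation induced by a bracketing on a groupoid `(α, mul)`. -/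
def Bracketing.eval {α : Type*} (mul : α → α → α) : {n : ℕ} → Bracketing n → (Fin n → α) → α
  | _, .leaf, f => f ⟨0, Nat.one_pos⟩
  | _, .node l r, f =>
      mul (Bracketing.eval mul l fun i => f (Fin.castAdd _ i))
          (Bracketing.eval mul r fun i => f (Fin.natAdd _ i))

/-- The multiplication of the graph algebra `A(G)` of a digraph `G = (V, E)`;
`none` plays the role of `∞`. -/
noncomputable def gmul {V : Type*} (E : V → V → Prop) : Option V → Option V → Option V
  | some x, some y => if E x y then some x else none
  | _, _ => none

/-- The graph algebra `A(G)` satisfies the bracketing identity `t ≈ t'`. -/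
def GASat {V : Type*} (E : V → V → Prop) {n : ℕ} (t t' : Bracketing n) : Prop :=
  ∀ f : Fin n → Option V, t.eval (gmul E) f = t'.eval (gmul E) f

/-- `s_n(A(G))`: the number of distinct `n`-ary term operations induced by
bracketings of size `n` on the graph algebra of `(V, E)`. -/
noncomputable def assocSpectrum {V : Type*} (E : V → V → Prop) (n : ℕ) : ℕ :=
  Nat.card (Set.range fun t : Bracketing n => fun f : Fin n → Option V => t.eval (gmul E) f)

/-- Depth sequences of DFS trees (zag sequences): `d(x_1) = 0` and
`1 ≤ d(x_{i+1}) ≤ d(x_i) + 1`.  DFS trees of size `n` are in bijection with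
such sequences. -/
def IsZag (n : ℕ) (d : Fin n → ℕ) : Prop :=
  (∀ h : 0 < n, d ⟨0, h⟩ = 0) ∧
  ∀ (i : ℕ) (h : i + 1 < n),
    1 ≤ d ⟨i + 1, h⟩ ∧ d ⟨i + 1, h⟩ ≤ d ⟨i, Nat.lt_of_succ_lt h⟩ + 1

/-- `j` is the parent of `i` in the DFS tree with depth sequence `d`:
the largest index below `i` whose depth is `d i - 1`. -/
def isParent {n : ℕ} (d : Fin n → ℕ) (j i : Fin n) : Prop :=
  j < i ∧ d j + 1 = d i ∧ ∀ k : Fin n, j < k → k < i → d k + 1 ≠ d i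

/-- `j` is a vertex of the induced subtree rooted at `i` of the DFS tree with
depth sequence `d`. -/
def descend {n : ℕ} (d : Fin n → ℕ) (i j : Fin n) : Prop :=
  i ≤ j ∧ ∀ k : Fin n, i < k → k ≤ j → d i < d k

/-- The induced subtrees rooted at `i` of the DFS trees with depth sequences
`d` and `d'` are equal (same vertex sets and same relative depths). -/
def subtreeEq {n : ℕ} (d d' : Fin n → ℕ) (i : Fin n) : Prop :=
  (∀ j, descend d i j ↔ descend d' i j) ∧
  ∀ j, descend d i j → d j - d i = d' j - d' i

/-- The height of the induced subtree rooted at `i`. -/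
noncomputable def subHeight {n : ℕ} (d : Fin n → ℕ) (i : Fin n) : ℕ :=
  Finset.univ.sup fun j => if descend d i j then d j - d i else 0

/-- The depth sequence of the DFS tree `G(t)` of a bracketing `t`, as a list. -/
def Bracketing.depthList : {n : ℕ} → Bracketing n → List ℕ
  | _, .leaf => [0]
  | _, .node l r => l.depthList ++ r.depthList.map (· + 1)

theorem Bracketing.length_depthList : ∀ {n : ℕ} (t : Bracketing n), t.depthList.length = n
  | _, .leaf => rfl
  | _, .node l r => by simp [Bracketing.depthList, length_depthList l, length_depthList r]

/-- The depth sequence of the DFS tree `G(t)` of a bracketing `t`. -/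
def Bracketing.depth {n : ℕ} (t : Bracketing n) (i : Fin n) : ℕ :=
  t.depthList.get (Fin.cast t.length_depthList.symm i)

/-- The vertex `a` lies on a directed cycle, i.e. it belongs to a nontrivial
strongly connected component. -/
def inCycle {V : Type*} (E : V → V → Prop) (a : V) : Prop :=
  ∃ b, E a b ∧ Relation.ReflTransGen E b a

/-- `a` and `b` are mutually reachable. -/
def sameSCC {V : Type*} (E : V → V → Prop) (a b : V) : Prop :=
  Relation.ReflTransGen E a b ∧ Relation.ReflTransGen E b a

/-- `K` is a strongly connected component of `(V, E)`. -/
def IsSCC {V : Type*} (E : V → V → Prop) (K : Set V) : Prop :=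
  ∃ a, K = {b | sameSCC E a b}

/-- `K` is a nontrivial strongly connected component (contains an edge). -/
def IsNontrivialSCC {V : Type*} (E : V → V → Prop) (K : Set V) : Prop :=
  IsSCC E K ∧ ∃ u ∈ K, ∃ v ∈ K, E u v

/-- `w 0 → w 1 → ⋯ → w ℓ` is a walk in `(V, E)`. -/
def IsWalk {V : Type*} (E : V → V → Prop) (w : ℕ → V) (ℓ : ℕ) : Prop :=
  ∀ i, i < ℓ → E (w i) (w (i + 1))

/-- `w 0 → ⋯ → w ℓ` is an outlet: `w 0` lies in a nontrivial strongly connected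
component and `w 1 → ⋯ → w ℓ` is a pleasant path. -/
def IsOutlet {V : Type*} (E : V → V → Prop) (w : ℕ → V) (ℓ : ℕ) : Prop :=
  IsWalk E w ℓ ∧ inCycle E (w 0) ∧ ∀ i, 1 ≤ i → i ≤ ℓ → ¬ inCycle E (w i)

/-- `K` is an `m`-whirl with block structure `β`: the blocks are the fibres of
`β` (all nonempty), and the edges inside `K` are exactly those from a block to
the cyclically next one. -/
def IsWhirl {V : Type*} (E : V → V → Prop) (K : Set V) (m : ℕ) (β : V → ZMod m) : Prop :=
  1 ≤ m ∧ (∀ a ∈ K, ∀ b ∈ K, (E a b ↔ β b = β a + 1)) ∧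
  ∀ c : ZMod m, ∃ a ∈ K, β a = c

/-- The parameter `Y_{t,t'}`: the largest integer `m` such that all induced
subtrees of height at most `m` of the two DFS trees coincide. -/
noncomputable def Ypar {n : ℕ} (d d' : Fin n → ℕ) : ℤ :=
  sSup {m : ℤ | ∀ i : Fin n,
    ((subHeight d i : ℤ) ≤ m ∨ (subHeight d' i : ℤ) ≤ m) → subtreeEq d d' i}

/-- The parameter `Z_{t,t'}`: the smallest `m` such that some vertex has equal
induced subtrees of height `m` in the two DFS trees but different parents. -/
noncomputable def Zpar {n : ℕ} (d d' : Fin n → ℕ) : ℕ :=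
  sInf {m : ℕ | ∃ i : Fin n, subtreeEq d d' i ∧ subHeight d i = m ∧
    ¬ ∀ j, (isParent d j i ↔ isParent d' j i)}

/-- `R_n`: binary words of length `n` that do not start with `01`, do not end
with `10` and do not contain `101` (with `0 := false`, `1 := true`). -/
def Rset (n : ℕ) : Set (List Bool) :=
  {ρ | ρ.length = n ∧ ¬ [false, true] <+: ρ ∧ ¬ [true, false] <:+ ρ ∧
    ¬ [true, false, true] <:+: ρ}

/-- The three-element vertex set `{u, v, w}`. -/
inductive V3 : Type | u | v | w

/-- The edge relation of the digraph `G0` with edges `(u,v)`, `(u,w)`, `(w,w)`. -/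
def E0 : V3 → V3 → Prop
  | .u, .v => True
  | .u, .w => True
  | .w, .w => True
  | _, _ => False

/-- The edge relation of the induced subgraph on `W`. -/
def inducedE {V : Type*} (E : V → V → Prop) (W : Set V) : ↥W → ↥W → Prop :=
  fun x y => E x.1 y.1

/-- The weakly connected component of `a`. -/
def wcc {V : Type*} (E : V → V → Prop) (a : V) : Set V :=
  {b | Relation.ReflTransGen (fun x y => E x y ∨ E y x) a b}

/-- The bracketing `x_1 (x_2 x_3)`. -/
def assocL : Bracketing 3 := .node .leaf (.node .leaf .leaf)

/-- The bracketing `(x_1 x_2) x_3`. -/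
def assocR : Bracketing 3 := .node (.node .leaf .leaf) .leaf

/-- Left-nested bracketings `((⋯((x_1 x_2) x_3)⋯) x_{n-1}) x_n`. -/
inductive Bracketing.IsLeftNested : {n : ℕ} → Bracketing n → Prop
  | leaf : IsLeftNested .leaf
  | node {n : ℕ} {t : Bracketing n} : IsLeftNested t → IsLeftNested (.node t .leaf)

/-- The weakly connected component of `a` is associative: its graph algebra
satisfies `x_1 (x_2 x_3) ≈ (x_1 x_2) x_3`. -/
noncomputable def CompAssoc {V : Type*} (E : V → V → Prop) (a : V) : Prop :=
  GASat (inducedE E (wcc E a)) assocL assocR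

/-- The weakly connected component of `a` is a directed bipartite graph with at
least one edge. -/
def CompBip {V : Type*} (E : V → V → Prop) (a : V) : Prop :=
  (∃ f : ↥(wcc E a) → Bool, ∀ x y : ↥(wcc E a), inducedE E (wcc E a) x y →
    f x = true ∧ f y = false) ∧ ∃ x y : ↥(wcc E a), inducedE E (wcc E a) x y

/-- The map `ρ ↦ ρ1 / ρ00 / ρ1000` from `R_{n-1} ⊔ R_{n-2} ⊔ R_{n-4}`. -/
def psi (n : ℕ) : ↥(Rset (n - 1)) ⊕ ↥(Rset (n - 2)) ⊕ ↥(Rset (n - 4)) → List Bool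
  | .inl ρ => ρ.1 ++ [true]
  | .inr (.inl ρ) => ρ.1 ++ [false, false]
  | .inr (.inr ρ) => ρ.1 ++ [true, false, false, false]

/-- `p` is the parent of `x` in the DFS tree with depth sequence `d`, stated through the vertices
in between, all of which lie at least as deep as `x`. -/
def IsTreeEdge {n : ℕ} (d : Fin n → ℕ) (p x : Fin n) : Prop :=
  p < x ∧ d p + 1 = d x ∧ ∀ k, p < k → k < x → d x ≤ d k

/-- `f` is a homomorphism from the DFS tree with depth sequence `d` to `(V, E)`. -/
def IsTreeHom {V : Type*} (E : V → V → Prop) {n : ℕ} (d : Fin n → ℕ) (f : Fin n → V) : Prop :=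
  ∀ p x, IsTreeEdge d p x → E (f p) (f x)

namespace Bracketing

theorem size_pos : ∀ {n : ℕ}, Bracketing n → 0 < n
  | _, .leaf => Nat.one_pos
  | _, .node l _ => Nat.add_pos_left l.size_pos _

theorem depthList_eq_cons : ∀ {n : ℕ} (t : Bracketing n),
    ∃ s, t.depthList = 0 :: s ∧ ∀ x ∈ s, 0 < x
  | _, .leaf => ⟨[], rfl, by simp⟩
  | _, .node l r => by
    obtain ⟨s, hs, hpos⟩ := l.depthList_eq_cons
    refine ⟨s ++ r.depthList.map (· + 1), by simp [depthList, hs], fun x hx => ?_⟩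
    rcases List.mem_append.1 hx with hx | hx
    · exact hpos x hx
    · obtain ⟨y, -, rfl⟩ := List.mem_map.1 hx
      exact Nat.succ_pos y

theorem eq_nil_of_map_depthList_eq_append {m k : ℕ} (r : Bracketing m) (r' : Bracketing k)
    {a : List ℕ} (h : r.depthList.map (· + 1) = a ++ r'.depthList.map (· + 1)) : a = [] := by
  obtain ⟨s, hs, hpos⟩ := r.depthList_eq_cons
  obtain ⟨s', hs', -⟩ := r'.depthList_eq_cons
  rcases a with _ | ⟨x, a⟩
  · rfl
  · rw [hs, hs'] at h
    simp only [List.map_cons, List.cons_append, List.cons.injEq] at h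
    have h1 : 1 ∈ s.map (· + 1) := by rw [h.2]; simp
    obtain ⟨y, hy, hy1⟩ := List.mem_map.1 h1
    have := hpos y hy
    omega

theorem sigma_eq_of_depthList_eq : ∀ {n m : ℕ} (t : Bracketing n) (t' : Bracketing m),
    t.depthList = t'.depthList → (⟨n, t⟩ : Σ k, Bracketing k) = ⟨m, t'⟩
  | _, _, .leaf, .leaf, _ => rfl
  | _, _, .leaf, .node l r, h => by
    have := congrArg List.length h
    rw [length_depthList, length_depthList] at this
    have := l.size_pos
    have := r.size_pos
    omega
  | _, _, .node l r, .leaf, h => by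
    have := congrArg List.length h
    rw [length_depthList, length_depthList] at this
    have := l.size_pos
    have := r.size_pos
    omega
  | _, _, .node l r, .node l' r', h => by
    have key : l.depthList = l'.depthList ∧ r.depthList = r'.depthList := by
      simp only [depthList] at h
      have hinj : Function.Injective (List.map (· + 1 : ℕ → ℕ)) :=
        List.map_injective_iff.2 (add_left_injective 1)
      rcases List.append_eq_append_iff.1 h with ⟨a, h1, h2⟩ | ⟨a, h1, h2⟩
      · obtain rfl := eq_nil_of_map_depthList_eq_append _ _ h2
        exact ⟨by simpa using h1.symm, hinj (by simpa using h2)⟩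
      · obtain rfl := eq_nil_of_map_depthList_eq_append _ _ h2
        exact ⟨by simpa using h1, hinj (by simpa using h2.symm)⟩
    cases sigma_eq_of_depthList_eq l l' key.1
    cases sigma_eq_of_depthList_eq r r' key.2
    rfl

theorem depth_injective {n : ℕ} : Function.Injective (depth : Bracketing n → Fin n → ℕ) := by
  intro t t' h
  have hl : t.depthList = t'.depthList := by
    refine List.ext_getElem (by simp [length_depthList]) fun i h1 _ => ?_
    exact congrFun h ⟨i, t.length_depthList ▸ h1⟩
  simpa using sigma_eq_of_depthList_eq t t' hl

theorem depth_eq_zero_iff {n : ℕ} (t : Bracketing n) (i : Fin n) :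
    t.depth i = 0 ↔ i.val = 0 := by
  obtain ⟨s, hs, hpos⟩ := t.depthList_eq_cons
  obtain ⟨i, hi⟩ := i
  have hlen := t.length_depthList
  rcases i with _ | i
  · simp [depth, hs]
  · have hi' : i < s.length := by simp [hs] at hlen; omega
    have := hpos _ (List.getElem_mem hi')
    simp only [depth, List.get_eq_getElem, Fin.val_cast, hs, List.getElem_cons_succ]
    omega

theorem depth_node_castAdd {m k : ℕ} (l : Bracketing m) (r : Bracketing k) (i : Fin m) :
    (node l r).depth (Fin.castAdd k i) = l.depth i := by
  have hi : i.val < l.depthList.length := by simp [length_depthList]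
  exact List.getElem_append_left hi

theorem depth_node_natAdd {m k : ℕ} (l : Bracketing m) (r : Bracketing k) (i : Fin k) :
    (node l r).depth (Fin.natAdd m i) = r.depth i + 1 := by
  have hi : l.depthList.length ≤ m + i.val := by simp [length_depthList]
  refine (List.getElem_append_right hi).trans ?_
  simp [depth, length_depthList]

theorem depth_succ_le : ∀ {n : ℕ} (t : Bracketing n) (i j : Fin n), i.val + 1 = j.val →
    t.depth j ≤ t.depth i + 1
  | _, .leaf, i, j, h => by omega
  | _, .node (m := m) (k := k) l r, i, j, h => by
    induction i using Fin.addCases with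
    | left i =>
      induction j using Fin.addCases with
      | left j =>
        rw [depth_node_castAdd, depth_node_castAdd]
        exact l.depth_succ_le i j (by simpa using h)
      | right j =>
        have hj : r.depth j = 0 := (r.depth_eq_zero_iff j).2 (by
          simp only [Fin.val_castAdd, Fin.val_natAdd] at h; omega)
        rw [depth_node_natAdd, hj]
        omega
    | right i =>
      induction j using Fin.addCases with
      | left j =>
        simp only [Fin.val_castAdd, Fin.val_natAdd] at h; omega
      | right j =>
        rw [depth_node_natAdd, depth_node_natAdd]
        have := r.depth_succ_le i j (by simp only [Fin.val_natAdd] at h; omega)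
        omega

variable {m k : ℕ} (l : Bracketing m) (r : Bracketing k)

theorem isTreeEdge_node_castAdd_castAdd (a b : Fin m) :
    IsTreeEdge (node l r).depth (Fin.castAdd k a) (Fin.castAdd k b) ↔
      IsTreeEdge l.depth a b := by
  simp only [IsTreeEdge, depth_node_castAdd]
  refine and_congr Iff.rfl (and_congr Iff.rfl ⟨fun h c hac hcb => ?_,
    fun h c => ?_⟩)
  · have := h (Fin.castAdd k c) hac hcb
    rwa [depth_node_castAdd] at this
  · induction c using Fin.addCases with
    | left c => rw [depth_node_castAdd]; exact h c
    | right c =>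
      intro _ hcb
      simp only [Fin.lt_def, Fin.val_natAdd, Fin.val_castAdd] at hcb
      omega

theorem isTreeEdge_node_natAdd_natAdd (a b : Fin k) :
    IsTreeEdge (node l r).depth (Fin.natAdd m a) (Fin.natAdd m b) ↔
      IsTreeEdge r.depth a b := by
  simp only [IsTreeEdge, depth_node_natAdd]
  refine and_congr (Fin.natAdd_lt_natAdd_iff m) (and_congr (by omega) ⟨fun h c hac hcb => ?_,
    fun h c => ?_⟩)
  · have := h (Fin.natAdd m c) ((Fin.natAdd_lt_natAdd_iff m).2 hac) ((Fin.natAdd_lt_natAdd_iff m).2 hcb)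
    rw [depth_node_natAdd] at this
    omega
  · induction c using Fin.addCases with
    | left c =>
      intro hac
      simp only [Fin.lt_def, Fin.val_natAdd, Fin.val_castAdd] at hac
      omega
    | right c =>
      intro hac hcb
      have := h c ((Fin.natAdd_lt_natAdd_iff m).1 hac) ((Fin.natAdd_lt_natAdd_iff m).1 hcb)
      rw [depth_node_natAdd]
      omega

theorem not_isTreeEdge_node_natAdd_castAdd (a : Fin k) (b : Fin m) :
    ¬ IsTreeEdge (node l r).depth (Fin.natAdd m a) (Fin.castAdd k b) := by
  rintro ⟨h, -⟩
  simp only [Fin.lt_def, Fin.val_natAdd, Fin.val_castAdd] at h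
  omega

theorem isTreeEdge_node_castAdd_natAdd (a : Fin m) (b : Fin k) :
    IsTreeEdge (node l r).depth (Fin.castAdd k a) (Fin.natAdd m b) ↔
      a = ⟨0, l.size_pos⟩ ∧ b = ⟨0, r.size_pos⟩ := by
  simp only [IsTreeEdge, depth_node_castAdd, depth_node_natAdd]
  constructor
  · rintro ⟨-, hd, hk⟩
    have hb : b.val = 0 := by
      by_contra hb
      have := hk (Fin.natAdd m ⟨0, r.size_pos⟩)
        (by simp only [Fin.lt_def, Fin.val_natAdd, Fin.val_castAdd]; omega)
        (by simp only [Fin.lt_def, Fin.val_natAdd]; omega)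
      rw [depth_node_natAdd, (r.depth_eq_zero_iff ⟨0, r.size_pos⟩).2 rfl] at this
      exact hb ((r.depth_eq_zero_iff b).1 (by omega))
    have ha : a.val = 0 := by
      rw [(r.depth_eq_zero_iff b).2 hb] at hd
      exact (l.depth_eq_zero_iff a).1 (by omega)
    exact ⟨Fin.ext ha, Fin.ext hb⟩
  · rintro ⟨rfl, rfl⟩
    refine ⟨?_, ?_, fun c hc _ => ?_⟩
    · have := l.size_pos
      simp only [Fin.lt_def, Fin.val_natAdd, Fin.val_castAdd]; omega
    · rw [(l.depth_eq_zero_iff _).2 rfl, (r.depth_eq_zero_iff _).2 rfl]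
    · rw [(r.depth_eq_zero_iff _).2 rfl, Nat.zero_add, Nat.one_le_iff_ne_zero, Ne,
        depth_eq_zero_iff]
      simp only [Fin.lt_def, Fin.val_castAdd] at hc
      omega

theorem isTreeHom_node {V : Type*} (E : V → V → Prop) (f : Fin (m + k) → V) :
    IsTreeHom E (node l r).depth f ↔
      IsTreeHom E l.depth (fun i => f (Fin.castAdd k i)) ∧
      IsTreeHom E r.depth (fun i => f (Fin.natAdd m i)) ∧
      E (f (Fin.castAdd k ⟨0, l.size_pos⟩)) (f (Fin.natAdd m ⟨0, r.size_pos⟩)) := by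
  constructor
  · intro h
    exact ⟨fun p x hpx => h _ _ ((isTreeEdge_node_castAdd_castAdd l r p x).2 hpx),
      fun p x hpx => h _ _ ((isTreeEdge_node_natAdd_natAdd l r p x).2 hpx),
      h _ _ ((isTreeEdge_node_castAdd_natAdd l r _ _).2 ⟨rfl, rfl⟩)⟩
  · rintro ⟨hl, hr, h0⟩ p x hpx
    induction p using Fin.addCases with
    | left p =>
      induction x using Fin.addCases with
      | left x => exact hl _ _ ((isTreeEdge_node_castAdd_castAdd l r p x).1 hpx)
      | right x =>
        obtain ⟨rfl, rfl⟩ := (isTreeEdge_node_castAdd_natAdd l r p x).1 hpx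
        exact h0
    | right p =>
      induction x using Fin.addCases with
      | left x => exact absurd hpx (not_isTreeEdge_node_natAdd_castAdd l r p x)
      | right x => exact hr _ _ ((isTreeEdge_node_natAdd_natAdd l r p x).1 hpx)

theorem eval_gmul_some {V : Type*} (E : V → V → Prop) : ∀ {n : ℕ} (t : Bracketing n)
    (f : Fin n → V), t.eval (gmul E) (fun i => some (f i)) =
      if IsTreeHom E t.depth f then some (f ⟨0, t.size_pos⟩) else none
  | _, .leaf, f => by
    have h : IsTreeHom E leaf.depth f := fun p x hpx => by
      have := hpx.1
      omega
    simp [eval, h]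
  | _, .node l r, f => by
    simp only [eval, isTreeHom_node]
    rw [eval_gmul_some E l, eval_gmul_some E r]
    by_cases hl : IsTreeHom E l.depth (fun i => f (Fin.castAdd _ i))
    · by_cases hr : IsTreeHom E r.depth (fun i => f (Fin.natAdd _ i))
      · simp only [hl, hr, if_true, gmul, true_and]
        rfl
      · simp [hl, hr, gmul]
    · simp [hl, gmul]

end Bracketing

theorem GASat.isTreeHom_iff {V : Type*} {E : V → V → Prop} {n : ℕ} {t t' : Bracketing n}
    (h : GASat E t t') (f : Fin n → V) : IsTreeHom E t.depth f ↔ IsTreeHom E t'.depth f := by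
  have := h fun i => some (f i)
  rw [Bracketing.eval_gmul_some, Bracketing.eval_gmul_some] at this
  by_cases h1 : IsTreeHom E t.depth f <;> by_cases h2 : IsTreeHom E t'.depth f <;> simp_all

section Descendants

variable {n : ℕ} {d : Fin n → ℕ}

theorem descend_refl (i : Fin n) : descend d i i :=
  ⟨le_rfl, fun _ h1 h2 => absurd (h1.trans_le h2) (lt_irrefl _)⟩

theorem descend.depth_le {i j : Fin n} (h : descend d i j) : d i ≤ d j := by
  rcases h.1.eq_or_lt with rfl | hlt
  · exact le_rfl
  · exact (h.2 j hlt le_rfl).le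

theorem IsTreeEdge.descend_iff {p x : Fin n} (h : IsTreeEdge d p x) {i : Fin n} (hx : x ≠ i) :
    descend d i p ↔ descend d i x := by
  obtain ⟨hlt, hd, hk⟩ := h
  constructor
  · intro hp
    refine ⟨hp.1.trans hlt.le, fun k hik hkx => ?_⟩
    by_cases hkp : k ≤ p
    · exact hp.2 k hik hkp
    · have := hp.depth_le
      have : d x ≤ d k := by
        rcases hkx.eq_or_lt with rfl | hkx
        · exact le_rfl
        · exact hk k (not_le.1 hkp) hkx
      omega
  · intro hdx
    have hix : i < x := lt_of_le_of_ne hdx.1 hx.symm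
    refine ⟨?_, fun k hik hkp => hdx.2 k hik (hkp.trans hlt.le)⟩
    by_contra hip
    have h1 := hk i (not_le.1 hip) hix
    have h2 := hdx.2 x hix le_rfl
    omega

theorem exists_isTreeEdge_of_descend
    (hstep : ∀ i j : Fin n, i.val + 1 = j.val → d j ≤ d i + 1)
    {i x : Fin n} (h : descend d i x) (hne : x ≠ i) :
    ∃ p, descend d i p ∧ IsTreeEdge d p x := by
  have hix : i < x := lt_of_le_of_ne h.1 hne.symm
  let S : Finset (Fin n) := Finset.univ.filter fun p => p < x ∧ d p < d x
  have hiS : i ∈ S := by simp [S, hix, h.2 x hix le_rfl]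
  obtain ⟨p, hpS, hmax⟩ := S.exists_max_image id ⟨i, hiS⟩
  obtain ⟨hpx, hdp⟩ : p < x ∧ d p < d x := by simpa [S] using hpS
  have hk : ∀ k, p < k → k < x → d x ≤ d k := by
    intro k hpk hkx
    by_contra hlt
    exact absurd (hmax k (by simp [S, hkx, not_le.1 hlt])) (not_le.2 hpk)
  refine ⟨p, ⟨hmax i hiS, fun k hik hkp => h.2 k hik (hkp.trans hpx.le)⟩, hpx, ?_, hk⟩
  have hlt : p.val + 1 < n := by omega
  have h1 := hstep p ⟨p.val + 1, hlt⟩ rfl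
  have h2 : d x ≤ d ⟨p.val + 1, hlt⟩ := by
    rcases (show (⟨p.val + 1, hlt⟩ : Fin n) ≤ x by rw [Fin.le_def]; exact hpx).eq_or_lt
      with heq | hlt'
    · rw [heq]
    · exact hk _ (by simp [Fin.lt_def]) hlt'
  omega

theorem subHeight_le_iff {i : Fin n} {m : ℕ} :
    subHeight d i ≤ m ↔ ∀ j, descend d i j → d j - d i ≤ m := by
  simp only [subHeight, Finset.sup_le_iff, Finset.mem_univ, true_imp_iff]
  refine forall_congr' fun j => ?_
  by_cases h : descend d i j <;> simp [h]

end Descendants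

section Walks

variable {V : Type*} {E : V → V → Prop}

theorem sameSCC.exists_succ {a u : V} (ha : inCycle E a) (h : sameSCC E a u) :
    ∃ v, E u v ∧ sameSCC E a v := by
  rcases h.2.cases_head with rfl | ⟨v, huv, hv⟩
  · obtain ⟨b, hb, hba⟩ := ha
    exact ⟨b, hb, .single hb, hba⟩
  · exact ⟨v, huv, h.1.tail huv, hv⟩

theorem sameSCC.exists_pred {a u : V} (ha : inCycle E a) (h : sameSCC E a u) :
    ∃ v, E v u ∧ sameSCC E a v := by
  rcases h.1.cases_tail with rfl | ⟨v, hv, hvu⟩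
  · obtain ⟨b, hb, hba⟩ := ha
    obtain ⟨c, hbc, hca⟩ := Relation.TransGen.tail'_iff.1 (Relation.TransGen.head' hb hba)
    exact ⟨c, hca, hbc, .single hca⟩
  · exact ⟨v, hvu, hv, .head hvu h.2⟩

/-- A vertex on a directed cycle occurs at any prescribed position of an infinite walk inside its
strongly connected component. -/
theorem inCycle.exists_walk {a : V} (ha : inCycle E a) (N : ℕ) :
    ∃ v : ℕ → V, v N = a ∧ ∀ k, E (v k) (v (k + 1)) ∧ sameSCC E a (v k) := by
  induction N with
  | zero =>
    choose s hs using fun u : {u // sameSCC E a u} => u.2.exists_succ ha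
    let g : ℕ → {u // sameSCC E a u} := fun k =>
      (fun u => (⟨s u, (hs u).2⟩ : {u // sameSCC E a u}))^[k] ⟨a, .refl, .refl⟩
    refine ⟨fun k => (g k).1, rfl, fun k => ⟨?_, (g k).2⟩⟩
    simp only [g, Function.iterate_succ_apply']
    exact (hs _).1
  | succ N ih =>
    obtain ⟨v, hN, hv⟩ := ih
    obtain ⟨b, hb, hab⟩ := (hv 0).2.exists_pred ha
    refine ⟨fun k => Nat.casesOn k b v, hN, fun k => ?_⟩
    rcases k with _ | k
    · exact ⟨hb, hab⟩
    · exact hv k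

theorem IsWalk.reflTransGen {w : ℕ → V} {ℓ : ℕ} (h : IsWalk E w ℓ) {a b : ℕ} (hab : a ≤ b)
    (hb : b ≤ ℓ) : Relation.ReflTransGen E (w a) (w b) := by
  induction b, hab using Nat.le_induction with
  | base => exact .refl
  | succ b _ ih => exact (ih (by omega)).tail (h b (by omega))

end Walks

/-- If `d` and `d'` satisfy that every homomorphism from the first tree to `(V, E)` is also one
from the second, then in the second tree a vertex `i` whose induced subtree in the first tree is
lower than some outlet has no more descendants than in the first tree, and at no greater depth. -/
theorem IsOutlet.descend_and_depth_le {V : Type*} {E : V → V → Prop} {w : ℕ → V} {ℓ : ℕ}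
    (hout : IsOutlet E w ℓ) {n : ℕ} {d d' : Fin n → ℕ}
    (hstep : ∀ i j : Fin n, i.val + 1 = j.val → d' j ≤ d' i + 1)
    (hhom : ∀ f : Fin n → V, IsTreeHom E d f → IsTreeHom E d' f)
    {i : Fin n} (hi : subHeight d i < ℓ) (x : Fin n) (hx : descend d' i x) :
    descend d i x ∧ d' x - d' i ≤ d x - d i := by
  obtain ⟨hwalk, hcyc, hpl⟩ := hout
  obtain ⟨v, hv0, hv⟩ := hcyc.exists_walk (d i - 1)
  have hht : ∀ j, descend d i j → d j - d i + 1 ≤ ℓ := fun j hj => by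
    have := subHeight_le_iff.1 le_rfl j hj
    omega
  let f : Fin n → V := fun x => if descend d i x then w (d x - d i + 1) else v (d x)
  have hf : IsTreeHom E d f := by
    intro p x hpx
    by_cases hxi : x = i
    · subst hxi
      have hp : ¬ descend d x p := fun h => absurd hpx.1 (not_lt.2 h.1)
      have h0 : d p = d x - 1 := by have := hpx.2.1; omega
      simp only [f, hp, descend_refl, if_true, if_false, h0, hv0, Nat.sub_self]
      exact hwalk 0 (by omega)
    · have hiff := hpx.descend_iff hxi
      by_cases hp : descend d i p
      · have hx := hiff.1 hp
        simp only [f, hp, hx, if_true]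
        have h1 := hp.depth_le
        have h2 := hht x hx
        have h3 := hpx.2.1
        rw [show d x - d i = d p - d i + 1 by omega]
        exact hwalk _ (by omega)
      · simp only [f, hp, mt hiff.2 hp, if_false, ← hpx.2.1]
        exact (hv _).1
  have hf' := hhom f hf
  induction x using WellFoundedLT.induction with
  | ind x ih =>
  by_cases hxi : x = i
  · subst hxi
    exact ⟨descend_refl _, by simp⟩
  obtain ⟨p, hp, hpx⟩ := exists_isTreeEdge_of_descend hstep hx hxi
  obtain ⟨hpd, hple⟩ := ih p hpx.1 hp
  have hE := hf' p x hpx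
  have hpℓ := hht p hpd
  have hpn := hpl (d p - d i + 1) (by omega) hpℓ
  by_cases hxd : descend d i x
  · refine ⟨hxd, ?_⟩
    simp only [f, hpd, hxd, if_true] at hE
    have hlt : d p - d i < d x - d i := by
      by_contra hle
      exact hpn ⟨_, hE, hwalk.reflTransGen (by omega) hpℓ⟩
    have h1 := hp.depth_le
    have h2 := hpx.2.1
    omega
  · simp only [f, hpd, hxd, if_true, if_false] at hE
    exact absurd ⟨_, hE, (hv _).2.2.trans (hwalk.reflTransGen (Nat.zero_le _) hpℓ)⟩ hpn

theorem IsOutlet.subtreeEq {V : Type*} {E : V → V → Prop} {w : ℕ → V} {ℓ : ℕ}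
    (hout : IsOutlet E w ℓ) {n : ℕ} {t t' : Bracketing n} (hsat : GASat E t t')
    {i : Fin n} (hi : subHeight t.depth i < ℓ) : subtreeEq t.depth t'.depth i := by
  have h1 := hout.descend_and_depth_le t'.depth_succ_le (fun f => (hsat.isTreeHom_iff f).1) hi
  have hi' : subHeight t'.depth i < ℓ := by
    refine lt_of_le_of_lt (subHeight_le_iff.2 fun j hj => ?_) hi
    exact (h1 j hj).2.trans (subHeight_le_iff.1 le_rfl j (h1 j hj).1)
  have h2 := hout.descend_and_depth_le t.depth_succ_le (fun f => (hsat.isTreeHom_iff f).2) hi'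
  exact ⟨fun j => ⟨fun hj => (h2 j hj).1, fun hj => (h1 j hj).1⟩,
    fun j hj => le_antisymm (h2 j hj).2 (h1 j (h2 j hj).1).2⟩

theorem subtreeEq.symm {n : ℕ} {d d' : Fin n → ℕ} {i : Fin n} (h : subtreeEq d d' i) :
    subtreeEq d' d i :=
  ⟨fun j => (h.1 j).symm, fun j hj => (h.2 j ((h.1 j).2 hj)).symm⟩

theorem Bracketing.eq_of_subtreeEq_root {n : ℕ} {t t' : Bracketing n}
    (h : subtreeEq t.depth t'.depth ⟨0, t.size_pos⟩) : t = t' := by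
  refine depth_injective (funext fun j => ?_)
  have h0 : t.depth ⟨0, t.size_pos⟩ = 0 := (t.depth_eq_zero_iff _).2 rfl
  have h0' : t'.depth ⟨0, t.size_pos⟩ = 0 := (t'.depth_eq_zero_iff _).2 rfl
  have hj : descend t.depth ⟨0, t.size_pos⟩ j := by
    refine ⟨Fin.le_def.2 (Nat.zero_le _), fun k hk _ => ?_⟩
    rw [h0, Nat.pos_iff_ne_zero, Ne, depth_eq_zero_iff]
    exact Nat.pos_iff_ne_zero.1 hk
  simpa [h0, h0'] using h.2 j hj

/-- Lemma 7.8: if the graph algebra of `(V, E)` satisfies a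
nontrivial bracketing identity `t ≈ t'`, then every outlet in the digraph has
length at most `Y_{t,t'} + 1`, i.e. `O_G ≤ Y_{t,t'} + 1`. -/
theorem outlet_le_Ypar_add_one {V : Type*} (E : V → V → Prop) {n : ℕ}
    (t t' : Bracketing n) (hne : t ≠ t') (hsat : GASat E t t')
    (w : ℕ → V) (ℓ : ℕ) (hout : IsOutlet E w ℓ) :
    (ℓ : ℤ) ≤ Ypar t.depth t'.depth + 1 := by
  refine sub_le_iff_le_add.1 (le_csSup ⟨subHeight t.depth ⟨0, t.size_pos⟩, fun m hm => ?_⟩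
    fun i hi => ?_)
  · by_contra hlt
    exact hne (Bracketing.eq_of_subtreeEq_root (hm _ (.inl (not_le.1 hlt).le)))
  · rcases hi with hi | hi
    · exact hout.subtreeEq hsat (by omega)
    · exact (hout.subtreeEq (fun f => (hsat f).symm) (by omega)).symm
end

section
/- Let G be an undirected graph (a digraph with symmetric edge relation). If every connected component of G is either trivial (a single vertex without a loop) or a complete graph with all loops, then the graph algebra A(G) satisfies every bracketing identity, i.e., A(G) satisfies t ≈ t' for all n and all t, t' ∈ B_n. -/
open Classical

/-- In a semigroup, a bracketing evaluates to the product of the list of its arguments. -/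
theorem Bracketing.coe_eval_mul {S : Type*} [Semigroup S] :
    ∀ {n : ℕ} (t : Bracketing n) (f : Fin n → S),
      ((t.eval (· * ·) f : S) : WithOne S) =
        ((List.ofFn f).map ((↑) : S → WithOne S)).prod
  | _, .leaf, f => by simp [Bracketing.eval]
  | _, .node l r, f => by
      simp only [Bracketing.eval, WithOne.coe_mul, l.coe_eval_mul, r.coe_eval_mul,
        List.ofFn_add, List.map_append, List.prod_append]
      rfl

/-- An associative operation takes the same value on all bracketings of the same size. -/
theorem Bracketing.eval_eq_of_assoc {α : Type*} (mul : α → α → α)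
    (hassoc : ∀ x y z, mul (mul x y) z = mul x (mul y z)) {n : ℕ} (t t' : Bracketing n)
    (f : Fin n → α) : t.eval mul f = t'.eval mul f := by
  let _ : Semigroup α := { mul := mul, mul_assoc := hassoc }
  exact WithOne.coe_injective ((t.coe_eval_mul f).trans (t'.coe_eval_mul f).symm)

/-- A graph algebra is associative if adjacent vertices `x → y` have the same out-neighbours. -/
theorem gmul_assoc {V : Type*} (E : V → V → Prop)
    (h : ∀ x y z, E x y → (E x z ↔ E y z)) (x y z : Option V) :
    gmul E (gmul E x y) z = gmul E x (gmul E y z) := by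
  rcases x with _ | x <;> rcases y with _ | y <;> rcases z with _ | z
  case some.some.some =>
    by_cases hxy : E x y
    · by_cases hyz : E y z <;> simp [gmul, hxy, hyz, h x y z hxy]
    · by_cases hyz : E y z <;> simp [gmul, hxy, hyz]
  all_goals simp only [gmul]
  all_goals split_ifs <;> rfl

/-- if every connected component of an undirected graph `(V, E)`
is trivial (a single vertex without a loop) or a complete graph with all loops,
then its graph algebra satisfies every bracketing identity. -/
theorem undirected_satisfies_all {V : Type*} (E : V → V → Prop)
    (hsym : ∀ a b, E a b → E b a)
    (hcomp : ∀ a : V,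
      ((∀ b, Relation.ReflTransGen E a b → b = a) ∧ ¬ E a a) ∨
      (∀ b c, Relation.ReflTransGen E a b → Relation.ReflTransGen E a c → E b c)) :
    ∀ (n : ℕ) (t t' : Bracketing n), GASat E t t' := by
  refine fun n t t' f => t.eval_eq_of_assoc _ (gmul_assoc E fun x y z hxy => ?_) t' f
  rcases hcomp x with ⟨htriv, hloop⟩ | hcompl
  · exact absurd (htriv y (.single hxy) ▸ hxy) hloop
  · exact ⟨fun hxz => hcompl y z (.single hxy) (.single hxz),
      fun hyz => hcompl x z .refl (.head hxy (.single hyz))⟩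
end

section
/- Let G be an undirected graph (a digraph with symmetric edge relation). The graph algebra A(G) satisfies some nontrivial bracketing identity (i.e., A(G) satisfies t ≈ t' for some n and some t, t' ∈ B_n with t ≠ t') if and only if every connected component of G is trivial (a single vertex without a loop), or a complete graph with all loops, or a complete bipartite graph. -/
open Classical

/-- The parent-child relation of the DFS tree of a bracketing, on indices counted from `0`. -/
def Bracketing.edge : {n : ℕ} → Bracketing n → ℕ → ℕ → Prop
  | _, .leaf, _, _ => False
  | _, @Bracketing.node m _ l r, u, v =>
      l.edge u v ∨ (u = 0 ∧ v = m) ∨ ∃ u' v', u = m + u' ∧ v = m + v' ∧ r.edge u' v'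

theorem Bracketing.pos {n : ℕ} (t : Bracketing n) : 0 < n := by
  induction t with
  | leaf => exact Nat.one_pos
  | node l r hl hr => omega

theorem Bracketing.edge_lt {n : ℕ} (t : Bracketing n) :
    ∀ {u v : ℕ}, t.edge u v → u < v ∧ v < n := by
  induction t with
  | leaf => intro u v h; exact h.elim
  | node l r hl hr =>
    have := l.pos
    have := r.pos
    rintro u v (h | ⟨rfl, rfl⟩ | ⟨u', v', rfl, rfl, h⟩)
    · have := hl h
      omega
    · omega
    · have := hr h
      omega

/-- Restricting the tree of a product to its left block gives the tree of the left factor. -/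
theorem Bracketing.edge_node_iff_left {m k : ℕ} (l : Bracketing m) (r : Bracketing k) {u v : ℕ}
    (hv : v < m) : (Bracketing.node l r).edge u v ↔ l.edge u v := by
  constructor
  · rintro (h | ⟨rfl, rfl⟩ | ⟨u', v', rfl, rfl, h⟩)
    · exact h
    · omega
    · omega
  · exact Or.inl

/-- Restricting the tree of a product to its right block gives the tree of the right factor. -/
theorem Bracketing.edge_node_iff_right {m k : ℕ} (l : Bracketing m) (r : Bracketing k) {u v : ℕ} :
    (Bracketing.node l r).edge (m + u) (m + v) ↔ r.edge u v := by
  constructor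
  · rintro (h | ⟨h, -⟩ | ⟨u', v', hu, hv, h⟩)
    · have := l.edge_lt h
      omega
    · have := l.pos
      omega
    · obtain rfl : u = u' := by omega
      obtain rfl : v = v' := by omega
      exact h
  · exact fun h => Or.inr (Or.inr ⟨u, v, rfl, rfl, h⟩)

/-- No child of the root of a product exceeds the size of the left factor. -/
theorem Bracketing.le_of_edge_node {m k : ℕ} (l : Bracketing m) (r : Bracketing k) {v : ℕ}
    (h : (Bracketing.node l r).edge 0 v) : v ≤ m := by
  rcases h with h | ⟨-, rfl⟩ | ⟨u', v', hu, -, -⟩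
  · exact (l.edge_lt h).2.le
  · exact le_rfl
  · have := l.pos
    omega

theorem Bracketing.heq_of_edge {n : ℕ} (t : Bracketing n) :
    ∀ {n' : ℕ} (t' : Bracketing n'), n = n' → (∀ u v, t.edge u v ↔ t'.edge u v) → HEq t t' := by
  induction t with
  | leaf =>
    intro n' t' hn _
    cases t' with
    | leaf => rfl
    | node l r =>
      have := l.pos
      have := r.pos
      omega
  | @node m k l r hl hr =>
    intro n' t' hn h
    cases t' with
    | leaf =>
      have := l.pos
      have := r.pos
      omega
    | @node m' k' l' r' =>
      have h₁ : m ≤ m' := l'.le_of_edge_node r' ((h 0 m).1 (Or.inr (Or.inl ⟨rfl, rfl⟩)))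
      have h₂ : m' ≤ m := l.le_of_edge_node r ((h 0 m').2 (Or.inr (Or.inl ⟨rfl, rfl⟩)))
      obtain rfl : m = m' := le_antisymm h₁ h₂
      obtain rfl : k = k' := by omega
      have el : l = l' := by
        refine eq_of_heq (hl l' rfl fun u v => ?_)
        by_cases hv : v < m
        · rw [← l.edge_node_iff_left r hv, h, l'.edge_node_iff_left r' hv]
        · exact ⟨fun e => absurd (l.edge_lt e).2 hv, fun e => absurd (l'.edge_lt e).2 hv⟩
      have er : r = r' := by
        refine eq_of_heq (hr r' rfl fun u v => ?_)
        rw [← l.edge_node_iff_right r, h, l'.edge_node_iff_right r']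
      rw [el, er]

theorem Bracketing.exists_edge_ne {n : ℕ} {t t' : Bracketing n} (h : t ≠ t') :
    ∃ u v, (t.edge u v ∧ ¬ t'.edge u v) ∨ (t'.edge u v ∧ ¬ t.edge u v) := by
  by_contra! hc
  exact h (eq_of_heq (t.heq_of_edge t' rfl fun u v => ⟨(hc u v).1, (hc u v).2⟩))

/-- A bracketing evaluates in a graph algebra to the value at the root if the assignment is a
homomorphism from its tree, and to `∞` otherwise. -/
theorem Bracketing.eval_gmul {V : Type*} (E : V → V → Prop) {n : ℕ} (t : Bracketing n) :
    ∀ φ : ℕ → V, t.eval (gmul E) (fun i => some (φ i)) =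
      if ∀ u v, t.edge u v → E (φ u) (φ v) then some (φ 0) else none := by
  induction t with
  | leaf => intro φ; simp [Bracketing.eval, Bracketing.edge]
  | @node m k l r hl hr =>
    intro φ
    have h₁ := hl φ
    have h₂ := hr fun i => φ (m + i)
    have key : (∀ u v, (Bracketing.node l r).edge u v → E (φ u) (φ v)) ↔
        (∀ u v, l.edge u v → E (φ u) (φ v)) ∧
        (∀ u v, r.edge u v → E (φ (m + u)) (φ (m + v))) ∧ E (φ 0) (φ m) := by
      constructor
      · exact fun h => ⟨fun u v e => h _ _ (Or.inl e),
          fun u v e => h _ _ (Or.inr (Or.inr ⟨u, v, rfl, rfl, e⟩)),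
          h _ _ (Or.inr (Or.inl ⟨rfl, rfl⟩))⟩
      · rintro ⟨hl', hr', h0⟩ u v (h | ⟨rfl, rfl⟩ | ⟨u', v', rfl, rfl, h⟩)
        · exact hl' _ _ h
        · exact h0
        · exact hr' _ _ h
    simp only [Bracketing.eval, Fin.val_castAdd, Fin.val_natAdd, h₁, h₂, key]
    generalize (∀ u v, l.edge u v → E (φ u) (φ v)) = a
    generalize (∀ u v, r.edge u v → E (φ (m + u)) (φ (m + v))) = b
    by_cases a <;> by_cases b <;> simp [*, gmul]

theorem GASat.hom_iff {V : Type*} {E : V → V → Prop} {n : ℕ} {t t' : Bracketing n}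
    (h : GASat E t t') (φ : ℕ → V) :
    (∀ u v, t.edge u v → E (φ u) (φ v)) ↔ (∀ u v, t'.edge u v → E (φ u) (φ v)) := by
  have := h fun i => some (φ i)
  rw [t.eval_gmul, t'.eval_gmul] at this
  split_ifs at this with h₁ h₂ h₂
  · exact iff_of_true h₁ h₂
  · exact iff_of_false h₁ h₂

/-- The distance from a vertex `i` in the tree of a bracketing. -/
theorem Bracketing.exists_dist {n : ℕ} (t : Bracketing n) :
    ∀ i < n, ∃ δ : ℕ → ℕ, δ i = 0 ∧ (∀ j < n, δ j = 0 → j = i) ∧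
      (∀ j < n, δ j = 1 → t.edge i j ∨ t.edge j i) ∧
      ∀ u v, t.edge u v → δ v = δ u + 1 ∨ δ u = δ v + 1 := by
  induction t with
  | leaf =>
    intro i hi
    exact ⟨fun _ => 0, rfl, fun j hj _ => by omega, fun j _ h => by simp at h, fun u v h => h.elim⟩
  | @node m k l r hl hr =>
    intro i hi
    by_cases him : i < m
    · obtain ⟨δ, h0, hz, h1, hs⟩ := hl i him
      obtain ⟨ε, e0, ez, -, es⟩ := hr 0 r.pos
      refine ⟨fun j => if j < m then δ j else ε (j - m) + δ 0 + 1, by simp [him, h0], ?_, ?_, ?_⟩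
      · intro j hj h
        by_cases hjm : j < m
        · exact hz j hjm (by simpa [hjm] using h)
        · simp [hjm] at h
      · intro j hj h
        by_cases hjm : j < m
        · exact (h1 j hjm (by simpa [hjm] using h)).imp Or.inl Or.inl
        · simp only [hjm, if_false] at h
          have hi0 := hz 0 l.pos (by omega)
          have hj0 := ez (j - m) (by omega) (by omega)
          exact Or.inl (Or.inr (Or.inl ⟨hi0.symm, by omega⟩))
      · rintro u v (h | ⟨rfl, rfl⟩ | ⟨u', v', rfl, rfl, h⟩)
        · have hlt := l.edge_lt h
          simpa [hlt.2, hlt.1.trans hlt.2] using hs u v h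
        · simp [l.pos, e0]
        · have := es u' v' h
          simp only [Nat.not_lt.2 (Nat.le_add_right m _), if_false, Nat.add_sub_cancel_left]
          omega
    · obtain ⟨δ, h0, hz, h1, hs⟩ := hr (i - m) (by omega)
      obtain ⟨ε, e0, ez, -, es⟩ := hl 0 l.pos
      refine ⟨fun j => if j < m then ε j + δ 0 + 1 else δ (j - m), by simp [him, h0], ?_, ?_, ?_⟩
      · intro j hj h
        by_cases hjm : j < m
        · simp [hjm] at h
        · have := hz (j - m) (by omega) (by simpa [hjm] using h)
          omega
      · intro j hj h
        by_cases hjm : j < m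
        · simp only [hjm, if_true] at h
          have hi0 := hz 0 r.pos (by omega)
          have hj0 := ez j hjm (by omega)
          exact Or.inr (Or.inr (Or.inl ⟨hj0, by omega⟩))
        · exact (h1 (j - m) (by omega) (by simpa [hjm] using h)).imp
            (fun e => Or.inr (Or.inr ⟨_, _, by omega, by omega, e⟩))
            (fun e => Or.inr (Or.inr ⟨_, _, by omega, by omega, e⟩))
      · rintro u v (h | ⟨rfl, rfl⟩ | ⟨u', v', rfl, rfl, h⟩)
        · have hlt := l.edge_lt h
          have := es u v h
          simp only [hlt.2, hlt.1.trans hlt.2, if_true]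
          omega
        · simp [l.pos, e0]
        · simpa using hs u' v' h

/-- If every homomorphism from the tree of `t` is one from the tree of `t'`, which has an edge
that `t` lacks, then the endpoints of every walk of length three are adjacent. -/
theorem adj_of_walk_three {V : Type*} {E : V → V → Prop} (hsym : ∀ a b, E a b → E b a) {n : ℕ}
    {t t' : Bracketing n}
    (hom : ∀ φ : ℕ → V, (∀ u v, t.edge u v → E (φ u) (φ v)) → ∀ u v, t'.edge u v → E (φ u) (φ v))
    {i j : ℕ} (hij : t'.edge i j) (hnij : ¬ t.edge i j) {a b c d : V}
    (hab : E a b) (hbc : E b c) (hcd : E c d) : E a d := by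
  obtain ⟨hlt, hjn⟩ := t'.edge_lt hij
  obtain ⟨δ, h0, hz, h1, hs⟩ := t.exists_dist i (hlt.trans hjn)
  have hj0 : δ j ≠ 0 := fun h => hlt.ne' (hz j hjn h)
  have hj1 : δ j ≠ 1 := fun h => (h1 j hjn h).elim hnij fun e => by
    have := t.edge_lt e
    omega
  have walk : ∀ w : ℕ → V, (∀ k, E (w k) (w (k + 1))) → E (w 0) (w (δ j)) := by
    intro w hw
    have := hom (fun x => w (δ x)) (fun u v e => by
      rcases hs u v e with h | h
      · simpa only [h] using hw (δ u)
      · simpa only [h] using hsym _ _ (hw (δ v))) i j hij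
    simpa only [h0] using this
  rcases Nat.even_or_odd (δ j) with hev | hodd
  · have loop : ∀ x y, E x y → E x x := by
      intro x y hxy
      have := walk (fun k => if Even k then x else y) (fun k => by
        by_cases hk : Even k
        · simpa [hk, Nat.even_add_one] using hxy
        · simpa [hk, Nat.even_add_one] using hsym _ _ hxy)
      simpa [hev] using this
    have trans : ∀ x y z, E x y → E y z → E x z := by
      intro x y z hxy hyz
      have hzz := loop z y (hsym _ _ hyz)
      have := walk (fun k => if k = 0 then x else if k = 1 then y else z) (fun k => by
        rcases k with _ | _ | k <;> simp [hxy, hyz, hzz])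
      simpa [hj0, hj1] using this
    exact trans _ _ _ (trans _ _ _ hab hbc) hcd
  · have := walk (fun k => if k = 0 then a else if k = 1 then b else if Even k then c else d)
      (fun k => by
        rcases k with _ | _ | k
        · simpa using hab
        · simpa using hbc
        · by_cases hk : Even k
          · simpa [hk, Nat.even_add_one] using hcd
          · simpa [hk, Nat.even_add_one] using hsym _ _ hcd)
    simpa [hj0, hj1, Nat.not_even_iff_odd.2 hodd] using this

/-- In an undirected graph where the endpoints of every walk of length three are adjacent, each
component is trivial, complete with all loops, or complete bipartite. -/
theorem component_of_walk_three {V : Type*} {E : V → V → Prop} (hsym : ∀ a b, E a b → E b a)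
    (walk : ∀ a b c d, E a b → E b c → E c d → E a d) (a : V) :
    ((∀ b, Relation.ReflTransGen E a b → b = a) ∧ ¬ E a a) ∨
    (∀ b c, Relation.ReflTransGen E a b → Relation.ReflTransGen E a c → E b c) ∨
    (∃ f : V → Bool,
      (∀ b c, Relation.ReflTransGen E a b → Relation.ReflTransGen E a c →
        (E b c ↔ f b ≠ f c)) ∧
      (∃ b, Relation.ReflTransGen E a b ∧ f b = true) ∧
      (∃ c, Relation.ReflTransGen E a c ∧ f c = false)) := by
  by_cases hnbr : ∃ b, E a b
  swap
  · push Not at hnbr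
    refine Or.inl ⟨fun b hb => ?_, hnbr a⟩
    rcases hb.cases_head with h | ⟨c, hc, -⟩
    · exact h.symm
    · exact absurd hc (hnbr c)
  obtain ⟨b₀, hab₀⟩ := hnbr
  have hb₀a := hsym _ _ hab₀
  have reach : ∀ x, Relation.ReflTransGen E a x → E b₀ x ∨ E a x := by
    intro x hx
    induction hx with
    | refl => exact Or.inl hb₀a
    | tail _ hxy ih =>
      rcases ih with h | h
      · exact Or.inr (walk _ _ _ _ hab₀ h hxy)
      · exact Or.inl (walk _ _ _ _ hb₀a h hxy)
  by_cases haa : E a a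
  · have all : ∀ x, Relation.ReflTransGen E a x → E a x := fun x hx =>
      (reach x hx).elim (fun h => walk _ _ _ _ haa hab₀ h) id
    exact Or.inr (Or.inl fun b c hb hc => walk _ _ _ _ (hsym _ _ (all b hb)) haa (all c hc))
  refine Or.inr (Or.inr ⟨fun x => decide (E a x), fun b c hb hc => ?_,
    ⟨b₀, .single hab₀, by simpa using hab₀⟩, ⟨a, .refl, by simpa using haa⟩⟩)
  have hb' := reach b hb
  have hc' := reach c hc
  by_cases hab : E a b <;> by_cases hac : E a c <;>
    simp only [hab, hac, or_true, or_false] at hb' hc'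
  · simpa [hab, hac] using fun h => haa (walk _ _ _ _ hab h (hsym _ _ hac))
  · simpa [hab, hac] using walk _ _ _ _ (hsym _ _ hab) hab₀ hc'
  · simpa [hab, hac] using walk _ _ _ _ (hsym _ _ hb') hb₀a hac
  · simpa [hab, hac] using fun h => haa
      (walk _ _ _ _ hab₀ (walk _ _ _ _ hb' h (hsym _ _ hc')) hb₀a)

/-- `x₁ (x₂ (x₃ x₄)) ≈ (x₁ (x₂ x₃)) x₄` holds in the graph algebra as soon as the ends of two
adjacent edges have the same neighbours. -/
theorem gaSat_of_neighbors {V : Type*} {E : V → V → Prop}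
    (h : ∀ x y z w, E x y → E y z → (E z w ↔ E x w)) :
    GASat (n := 4) E (.node .leaf (.node .leaf (.node .leaf .leaf)))
      (.node (.node .leaf (.node .leaf .leaf)) .leaf) := by
  have key : ∀ p q r s : Option V, gmul E p (gmul E q (gmul E r s)) =
      gmul E (gmul E p (gmul E q r)) s := by
    have none_mul : ∀ p, gmul E none p = none := fun _ => rfl
    have mul_none : ∀ p, gmul E p none = none := by rintro (_ | _) <;> rfl
    have some_mul : ∀ x y, gmul E (some x) (some y) = if E x y then some x else none :=
      fun _ _ => rfl
    rintro (_ | x) (_ | y) (_ | z) (_ | w) <;> try simp only [none_mul, mul_none]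
    have := h x y z w
    by_cases h₁ : E x y <;> by_cases h₂ : E y z <;> by_cases h₃ : E z w <;>
      by_cases h₄ : E x w <;> simp_all
  exact fun f => key (f 0) (f 1) (f 2) (f 3)

/-- an undirected graph `(V, E)` satisfies some nontrivial
bracketing identity iff every connected component is trivial (a single vertex
without a loop), a complete graph with all loops, or a complete bipartite
graph. -/
theorem undirected_satisfies_some_iff {V : Type*} (E : V → V → Prop)
    (hsym : ∀ a b, E a b → E b a) :
    (∃ (n : ℕ) (t t' : Bracketing n), t ≠ t' ∧ GASat E t t') ↔
    (∀ a : V,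
      ((∀ b, Relation.ReflTransGen E a b → b = a) ∧ ¬ E a a) ∨
      (∀ b c, Relation.ReflTransGen E a b → Relation.ReflTransGen E a c → E b c) ∨
      (∃ f : V → Bool,
        (∀ b c, Relation.ReflTransGen E a b → Relation.ReflTransGen E a c →
          (E b c ↔ f b ≠ f c)) ∧
        (∃ b, Relation.ReflTransGen E a b ∧ f b = true) ∧
        (∃ c, Relation.ReflTransGen E a c ∧ f c = false))) := by
  constructor
  · rintro ⟨n, t, t', hne, hsat⟩
    obtain ⟨i, j, ⟨h, h'⟩ | ⟨h, h'⟩⟩ := Bracketing.exists_edge_ne hne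
    · exact component_of_walk_three hsym fun a b c d hab hbc hcd =>
        adj_of_walk_three hsym (fun φ => (hsat.hom_iff φ).2) h h' hab hbc hcd
    · exact component_of_walk_three hsym fun a b c d hab hbc hcd =>
        adj_of_walk_three hsym (fun φ => (hsat.hom_iff φ).1) h h' hab hbc hcd
  · intro h
    refine ⟨4, _, _, fun e => ?_, gaSat_of_neighbors fun x y z w hxy hyz => ?_⟩
    · have := congrArg Bracketing.depthList e
      simp [Bracketing.depthList] at this
    · have hx : Relation.ReflTransGen E x x := .refl
      have hy : Relation.ReflTransGen E x y := .single hxy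
      have hz := hy.tail hyz
      rcases h x with ⟨h₁, h₂⟩ | h | ⟨f, hf, -⟩
      · exact absurd (h₁ y hy ▸ hxy) h₂
      · exact ⟨fun e => h x w hx (hz.tail e), fun e => h z w hz (hx.tail e)⟩
      · have h₁ := (hf x y hx hy).1 hxy
        have h₂ := (hf y z hy hz).1 hyz
        have hxz : f x = f z := by
          revert h₁ h₂
          cases f x <;> cases f y <;> cases f z <;> simp
        constructor
        · intro e
          have hw := hz.tail e
          rw [hf x w hx hw, hxz]
          exact (hf z w hz hw).1 e
        · intro e
          have hw := hx.tail e
          rw [hf z w hz hw, ← hxz]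
          exact (hf x w hx hw).1 e
end

section
/- For every n ≥ 6, the cardinality of R_n satisfies the recurrence |R_n| = |R_{n−1}| + |R_{n−2}| + |R_{n−4}|. Moreover, for n ≥ 6 the map sending ρ ∈ R_{n−1} to ρ1, ρ ∈ R_{n−2} to ρ00, and ρ ∈ R_{n−4} to ρ1000 is a bijection from the disjoint union R_{n−1} ⊔ R_{n−2} ⊔ R_{n−4} onto R_n. -/
open Classical

theorem List.concat_suffix_concat {α : Type*} {l m : List α} {a b : α} :
    l ++ [a] <:+ m ++ [b] ↔ a = b ∧ l <:+ m := by
  rw [← List.reverse_prefix]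
  simp

theorem List.prefix_append_iff_of_length_le {α : Type*} {l m k : List α}
    (h : l.length ≤ m.length) : l <+: m ++ k ↔ l <+: m :=
  ⟨fun hl => List.prefix_of_prefix_length_le hl (List.prefix_append m k) h,
    fun hl => List.prefix_append_of_prefix hl⟩

theorem suffix_one_zero_concat {ρ : List Bool} {b : Bool} :
    [true, false] <:+ ρ ++ [b] ↔ b = false ∧ [true] <:+ ρ := by
  simpa [eq_comm] using List.concat_suffix_concat (l := [true]) (m := ρ) (a := false) (b := b)

theorem infix_one_zero_one_concat {ρ : List Bool} {b : Bool} :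
    [true, false, true] <:+: ρ ++ [b] ↔
      (b = true ∧ [true, false] <:+ ρ) ∨ [true, false, true] <:+: ρ := by
  have h := List.concat_suffix_concat (l := [true, false]) (m := ρ) (a := true) (b := b)
  rw [List.infix_concat_iff]
  simpa [eq_comm] using or_congr_left h

theorem concat_true_mem_Rset {n : ℕ} (hn : 2 ≤ n) {ρ : List Bool} :
    ρ ++ [true] ∈ Rset (n + 1) ↔ ρ ∈ Rset n := by
  by_cases hρ : ρ.length = n
  · have h := List.prefix_append_iff_of_length_le (l := [false, true]) (m := ρ) (k := [true])
      (by simpa [hρ] using hn)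
    simp [Rset, h, hρ, suffix_one_zero_concat, infix_one_zero_one_concat]
  · simp [Rset, hρ]

theorem append_zero_zero_mem_Rset {n : ℕ} (hn : 2 ≤ n) {ρ : List Bool} :
    ρ ++ [false, false] ∈ Rset (n + 2) ↔
      ρ.length = n ∧ ¬ [false, true] <+: ρ ∧ ¬ [true, false, true] <:+: ρ := by
  by_cases hρ : ρ.length = n
  · have h := List.prefix_append_iff_of_length_le (l := [false, true]) (m := ρ)
      (k := [false, false]) (by simpa [hρ] using hn)
    have e : ρ ++ [false, false] = ρ ++ [false] ++ [false] := by simp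
    have hs : ¬ [true, false] <:+ ρ ++ [false, false] := by
      simp [e, suffix_one_zero_concat, -List.append_assoc]
    have hi : [true, false, true] <:+: ρ ++ [false, false] ↔ [true, false, true] <:+: ρ := by
      simp [e, infix_one_zero_one_concat, -List.append_assoc]
    simp [Rset, h, hρ, hs, hi]
  · simp [Rset, hρ]

theorem append_one_zero_zero_zero_mem_Rset {n : ℕ} (hn : 2 ≤ n) {ρ : List Bool} :
    ρ ++ [true, false, false, false] ∈ Rset (n + 4) ↔ ρ ∈ Rset n := by
  have e : ρ ++ [true, false, false, false] = ρ ++ [true] ++ [false] ++ [false, false] := by simp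
  rw [e, append_zero_zero_mem_Rset (n := n + 2) (by omega)]
  by_cases hρ : ρ.length = n
  · have h := List.prefix_append_iff_of_length_le (l := [false, true]) (m := ρ)
      (k := [true, false]) (by simpa [hρ] using hn)
    have hi : [true, false, true] <:+: ρ ++ [true] ++ [false] ↔
        [true, false] <:+ ρ ∨ [true, false, true] <:+: ρ := by
      simp [infix_one_zero_one_concat, -List.append_assoc]
    rw [hi]
    simp [Rset, h, hρ]
  · simp [Rset, hρ]

theorem finite_Rset (n : ℕ) : (Rset n).Finite :=
  (List.finite_length_eq Bool n).subset fun _ h => h.1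

theorem psi_injective (n : ℕ) : Function.Injective (psi n) := by
  have key : ∀ {ρ σ : List Bool}, ¬ [true, false] <:+ ρ →
      ρ ++ [false, false] ≠ σ ++ [true, false, false, false] := by
    intro ρ σ hρ h
    have h' : ρ ++ [false, false] = (σ ++ [true, false]) ++ [false, false] := by simpa using h
    exact hρ ⟨σ, (List.append_cancel_right h').symm⟩
  have key₁ : ∀ {ρ σ : List Bool}, ρ ++ [true] ≠ σ ++ [false] := by
    intro ρ σ h
    simpa using (List.append_inj' h rfl).2
  rintro (ρ | ρ | ρ) (σ | σ | σ) h <;> simp only [psi] at h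
  · exact congrArg _ (Subtype.ext (List.append_cancel_right h))
  · exact absurd (by simpa using h) (key₁ (ρ := ρ.1) (σ := σ.1 ++ [false]))
  · exact absurd (by simpa using h) (key₁ (ρ := ρ.1) (σ := σ.1 ++ [true, false, false]))
  · exact absurd (by simpa using h.symm) (key₁ (ρ := σ.1) (σ := ρ.1 ++ [false]))
  · exact congrArg _ (congrArg _ (Subtype.ext (List.append_cancel_right h)))
  · exact absurd h (key ρ.2.2.2.1)
  · exact absurd (by simpa using h.symm) (key₁ (ρ := σ.1) (σ := ρ.1 ++ [true, false, false]))
  · exact absurd h.symm (key σ.2.2.2.1)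
  · exact congrArg _ (congrArg _ (Subtype.ext (List.append_cancel_right h)))

theorem range_psi {n : ℕ} (hn : 6 ≤ n) : Set.range (psi n) = Rset n := by
  obtain ⟨k, rfl⟩ := Nat.exists_eq_add_of_le' (show 4 ≤ n by omega)
  have hk : 2 ≤ k := by omega
  ext w
  constructor
  · rintro ⟨ρ | ρ | ρ, rfl⟩
    · exact (concat_true_mem_Rset (n := k + 3) (by omega)).2 ρ.2
    · exact (append_zero_zero_mem_Rset (n := k + 2) (by omega)).2
        ⟨ρ.2.1, ρ.2.2.1, ρ.2.2.2.2⟩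
    · exact (append_one_zero_zero_zero_mem_Rset hk).2 ρ.2
  · intro hw
    rcases List.eq_nil_or_concat' w with rfl | ⟨v, b, rfl⟩
    · simp [Rset] at hw
    cases b with
    | true => exact ⟨.inl ⟨v, (concat_true_mem_Rset (n := k + 3) (by omega)).1 hw⟩, rfl⟩
    | false =>
      rcases List.eq_nil_or_concat' v with rfl | ⟨u, b, rfl⟩
      · simp [Rset] at hw
      cases b with
      | true => exact absurd ⟨u, by simp⟩ hw.2.2.1
      | false =>
        rw [List.append_assoc] at hw ⊢
        have hu := (append_zero_zero_mem_Rset (n := k + 2) (by omega)).1 hw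
        by_cases hs : [true, false] <:+ u
        · obtain ⟨t, rfl⟩ := hs
          rw [List.append_assoc] at hw ⊢
          exact ⟨.inr (.inr ⟨t, (append_one_zero_zero_zero_mem_Rset hk).1 hw⟩), rfl⟩
        · exact ⟨.inr (.inl ⟨u, hu.1, hu.2.1, hs, hu.2.2⟩), rfl⟩

/-- Lemma 9.1, recurrence: for `n ≥ 6`,
`|R_n| = |R_{n-1}| + |R_{n-2}| + |R_{n-4}|`, and the map
`ρ ↦ ρ1 / ρ00 / ρ1000` is a bijection from `R_{n-1} ⊔ R_{n-2} ⊔ R_{n-4}`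
onto `R_n`. -/
theorem Rset_recurrence (n : ℕ) (hn : 6 ≤ n) :
    (Nat.card (Rset n) =
      Nat.card (Rset (n - 1)) + Nat.card (Rset (n - 2)) + Nat.card (Rset (n - 4))) ∧
    Function.Injective (psi n) ∧ Set.range (psi n) = Rset n := by
  refine ⟨?_, psi_injective n, range_psi hn⟩
  have := (finite_Rset (n - 1)).to_subtype
  have := (finite_Rset (n - 2)).to_subtype
  have := (finite_Rset (n - 4)).to_subtype
  rw [← range_psi hn, Nat.card_range_of_injective (psi_injective n), Nat.card_sum, Nat.card_sum,
    add_assoc]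
end

section
/- Let α be the unique positive real root of the polynomial x^4 − x^3 − x^2 − 1 (α ≈ 1.755). Then |R_n| is asymptotically Θ(α^n): there exist positive real constants c_1, c_2 such that c_1·α^n ≤ |R_n| ≤ c_2·α^n for all n ≥ 2. -/
open Classical

/-- A word all of whose maximal blocks of `0` have length at least two. -/
def NoIsolatedZero (w : List Bool) : Prop :=
  w ≠ [false] ∧ ¬ [false, true] <+: w ∧ ¬ [true, false] <:+ w ∧ ¬ [true, false, true] <:+: w

theorem Rset_eq_noIsolatedZero {n : ℕ} (hn : 2 ≤ n) :
    Rset n = {w | w.length = n ∧ NoIsolatedZero w} := by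
  ext w
  simp only [Rset, NoIsolatedZero, Set.mem_ofPred_eq]
  refine and_congr_right fun hw => (and_iff_right ?_).symm
  rintro rfl
  simp at hw
  omega

theorem noIsolatedZero_nil : NoIsolatedZero [] := by
  simp [NoIsolatedZero]

theorem not_noIsolatedZero_false : ¬ NoIsolatedZero [false] := by
  simp [NoIsolatedZero]

theorem noIsolatedZero_false_false : NoIsolatedZero [false, false] := by
  simp [NoIsolatedZero, List.suffix_cons_iff, List.infix_cons_iff]

theorem noIsolatedZero_true_cons (w : List Bool) :
    NoIsolatedZero (true :: w) ↔ NoIsolatedZero w := by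
  simp [NoIsolatedZero, List.suffix_cons_iff, List.infix_cons_iff, eq_comm (a := [false])]
  tauto

theorem not_noIsolatedZero_false_true_cons (w : List Bool) :
    ¬ NoIsolatedZero (false :: true :: w) := by
  simp [NoIsolatedZero]

theorem noIsolatedZero_false_false_true_cons (w : List Bool) :
    NoIsolatedZero (false :: false :: true :: w) ↔ NoIsolatedZero w := by
  rw [← noIsolatedZero_true_cons w]
  simp [NoIsolatedZero, List.suffix_cons_iff, List.infix_cons_iff]

theorem noIsolatedZero_false_false_false_cons (w : List Bool) :
    NoIsolatedZero (false :: false :: false :: w) ↔ NoIsolatedZero (false :: false :: w) := by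
  simp [NoIsolatedZero, List.suffix_cons_iff, List.infix_cons_iff]

/-- The number of binary words of length `n` satisfying `P`. -/
noncomputable def wordCount (P : List Bool → Prop) (n : ℕ) : ℕ :=
  Nat.card {w : List Bool | w.length = n ∧ P w}

theorem wordCount_zero (P : List Bool → Prop) : wordCount P 0 = if P [] then 1 else 0 := by
  split_ifs with h
  · have : {w : List Bool | w.length = 0 ∧ P w} = {[]} := by
      ext w
      simp only [List.length_eq_zero_iff, Set.mem_ofPred_eq, Set.mem_singleton_iff]
      exact ⟨And.left, by rintro rfl; exact ⟨rfl, h⟩⟩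
    rw [wordCount, this]
    simp
  · have : {w : List Bool | w.length = 0 ∧ P w} = ∅ := by
      ext w
      simp only [List.length_eq_zero_iff, Set.mem_ofPred_eq, Set.mem_empty_iff_false, iff_false]
      rintro ⟨rfl, hw⟩
      exact h hw
    rw [wordCount, this]
    simp

theorem wordCount_succ (P : List Bool → Prop) (n : ℕ) :
    wordCount P (n + 1) =
      wordCount (fun w => P (true :: w)) n + wordCount (fun w => P (false :: w)) n := by
  have hfin (Q : List Bool → Prop) : {w : List Bool | w.length = n ∧ Q w}.Finite :=
    (List.finite_length_eq Bool n).subset fun _ h => h.1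
  have hunion : {w : List Bool | w.length = n + 1 ∧ P w} =
      List.cons true '' {w | w.length = n ∧ P (true :: w)} ∪
        List.cons false '' {w | w.length = n ∧ P (false :: w)} := by
    ext w
    rcases w with _ | ⟨_ | _, w⟩ <;> simp
  have hdisj : Disjoint (List.cons true '' {w | w.length = n ∧ P (true :: w)})
      (List.cons false '' {w | w.length = n ∧ P (false :: w)}) := by
    rw [Set.disjoint_left]
    rintro _ ⟨w, -, rfl⟩ ⟨v, -, h⟩
    simp at h
  simp only [wordCount, Nat.card_coe_set_eq]
  rw [hunion, Set.ncard_union_eq hdisj ((hfin _).image _) ((hfin _).image _),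
    Set.ncard_image_of_injective _ List.cons_injective,
    Set.ncard_image_of_injective _ List.cons_injective]

theorem wordCount_false (n : ℕ) : wordCount (fun _ => False) n = 0 := by
  simp [wordCount]

theorem wordCount_noIsolatedZero_succ (n : ℕ) :
    wordCount NoIsolatedZero (n + 1) =
      wordCount NoIsolatedZero n + wordCount (fun w => NoIsolatedZero (false :: w)) n := by
  simp only [wordCount_succ, noIsolatedZero_true_cons]

theorem wordCount_noIsolatedZero_false_succ (n : ℕ) :
    wordCount (fun w => NoIsolatedZero (false :: w)) (n + 1) =
      wordCount (fun w => NoIsolatedZero (false :: false :: w)) n := by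
  simp only [wordCount_succ, not_noIsolatedZero_false_true_cons, wordCount_false, zero_add]

theorem wordCount_noIsolatedZero_false_false_succ (n : ℕ) :
    wordCount (fun w => NoIsolatedZero (false :: false :: w)) (n + 1) =
      wordCount NoIsolatedZero n +
        wordCount (fun w => NoIsolatedZero (false :: false :: w)) n := by
  simp only [wordCount_succ, noIsolatedZero_false_false_true_cons,
    noIsolatedZero_false_false_false_cons]

section Growth

variable {α : ℝ} {a b c : ℕ → ℕ}

/-- The vector `(1, α - 1, α (α - 1))` is an eigenvector of the transfer matrix. -/
theorem le_mul_pow_of_transfer (hα : α * (α * (α - 1)) = 1 + α * (α - 1))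
    (ha : ∀ n, a (n + 1) = a n + b n) (hb : ∀ n, b (n + 1) = c n)
    (hc : ∀ n, c (n + 1) = a n + c n) {C : ℝ} (ha₀ : a 0 ≤ C) (hb₀ : b 0 ≤ C * (α - 1))
    (hc₀ : c 0 ≤ C * (α * (α - 1))) (n : ℕ) :
    a n ≤ C * α ^ n ∧ b n ≤ C * (α - 1) * α ^ n ∧ c n ≤ C * (α * (α - 1)) * α ^ n := by
  induction n with
  | zero => simpa using ⟨ha₀, hb₀, hc₀⟩
  | succ n ih =>
    obtain ⟨iha, ihb, ihc⟩ := ih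
    rw [ha, hb, hc]
    push_cast
    refine ⟨by linear_combination iha + ihb, by linear_combination ihc, ?_⟩
    linear_combination iha + ihc - C * α ^ n * hα

theorem mul_pow_le_of_transfer (hα : α * (α * (α - 1)) = 1 + α * (α - 1))
    (ha : ∀ n, a (n + 1) = a n + b n) (hb : ∀ n, b (n + 1) = c n)
    (hc : ∀ n, c (n + 1) = a n + c n) {C : ℝ} (ha₀ : C ≤ a 0) (hb₀ : C * (α - 1) ≤ b 0)
    (hc₀ : C * (α * (α - 1)) ≤ c 0) (n : ℕ) :
    C * α ^ n ≤ a n ∧ C * (α - 1) * α ^ n ≤ b n ∧ C * (α * (α - 1)) * α ^ n ≤ c n := by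
  induction n with
  | zero => simpa using ⟨ha₀, hb₀, hc₀⟩
  | succ n ih =>
    obtain ⟨iha, ihb, ihc⟩ := ih
    rw [ha, hb, hc]
    push_cast
    refine ⟨by linear_combination iha + ihb, by linear_combination ihc, ?_⟩
    linear_combination iha + ihc + C * α ^ n * hα

end Growth

/-- Lemma 9.1: if `α` is the (unique) positive real root of
`x⁴ - x³ - x² - 1`, then `|R_n| = Θ(αⁿ)`. -/
theorem Rset_card_isTheta (α : ℝ) (hpos : 0 < α)
    (hroot : α ^ 4 - α ^ 3 - α ^ 2 - 1 = 0) :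
    ∃ c₁ c₂ : ℝ, 0 < c₁ ∧ 0 < c₂ ∧
      ∀ n : ℕ, 2 ≤ n →
        c₁ * α ^ n ≤ (Nat.card (Rset n) : ℝ) ∧
        (Nat.card (Rset n) : ℝ) ≤ c₂ * α ^ n := by
  have hα : α * (α * (α - 1)) = 1 + α * (α - 1) := by
    have h : (α + 1) * (α * (α * (α - 1)) - (1 + α * (α - 1))) = 0 := by
      linear_combination hroot
    rcases mul_eq_zero.mp h with h | h <;> linarith
  have hone : 1 < α := by
    by_contra! h
    nlinarith [mul_nonneg hpos.le (sub_nonneg.mpr h),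
      mul_nonneg hpos.le (mul_nonneg hpos.le (sub_nonneg.mpr h))]
  have ha := wordCount_noIsolatedZero_succ
  have hb := wordCount_noIsolatedZero_false_succ
  have hc := wordCount_noIsolatedZero_false_false_succ
  have ha₀ : wordCount NoIsolatedZero 0 = 1 := by
    simp [wordCount_zero, noIsolatedZero_nil]
  have hb₀ : wordCount (fun w => NoIsolatedZero (false :: w)) 0 = 0 := by
    simp [wordCount_zero, not_noIsolatedZero_false]
  have hc₀ : wordCount (fun w => NoIsolatedZero (false :: false :: w)) 0 = 1 := by
    simp [wordCount_zero, noIsolatedZero_false_false]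
  have hprod : 0 < α * (α - 1) := mul_pos hpos (sub_pos.mpr hone)
  refine ⟨(α ^ 2)⁻¹ * α⁻¹, α, by positivity, hpos, fun n hn => ?_⟩
  have hcard : Nat.card (Rset n) = wordCount NoIsolatedZero n := by
    rw [Rset_eq_noIsolatedZero hn, wordCount]
  rw [hcard]
  constructor
  · obtain ⟨m, rfl⟩ : ∃ m, n = m + 1 := ⟨n - 1, by omega⟩
    have key (x : ℝ) (hx : x ≤ α ^ 2) : (α ^ 2)⁻¹ * x ≤ 1 := by
      rw [inv_mul_le_iff₀ (by positivity)]
      linarith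
    have ha₁ : wordCount NoIsolatedZero 1 = 1 := by rw [ha, ha₀, hb₀]
    have hb₁ : wordCount (fun w => NoIsolatedZero (false :: w)) 1 = 1 := by rw [hb, hc₀]
    have hc₁ : wordCount (fun w => NoIsolatedZero (false :: false :: w)) 1 = 2 := by
      rw [hc, ha₀, hc₀]
    have h := (mul_pow_le_of_transfer (a := fun k => wordCount NoIsolatedZero (k + 1))
      (b := fun k => wordCount (fun w => NoIsolatedZero (false :: w)) (k + 1))
      (c := fun k => wordCount (fun w => NoIsolatedZero (false :: false :: w)) (k + 1))
      (C := (α ^ 2)⁻¹) hα (fun k => ha (k + 1)) (fun k => hb (k + 1)) (fun k => hc (k + 1))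
      (by simpa [ha₁] using key 1 (by nlinarith))
      (by simpa [hb₁] using key (α - 1) (by nlinarith))
      (by
        simp only [zero_add, hc₁, Nat.cast_ofNat]
        linarith [key (α * (α - 1)) (by nlinarith)]) m).1
    calc (α ^ 2)⁻¹ * α⁻¹ * α ^ (m + 1) = (α ^ 2)⁻¹ * α ^ m := by
          rw [pow_succ' α m, mul_assoc, inv_mul_cancel_left₀ hpos.ne']
      _ ≤ _ := h
  · exact (le_mul_pow_of_transfer hα ha hb hc (by simpa [ha₀] using hone.le)
      (by simpa [hb₀] using hprod.le) (by rw [hc₀, hα]; push_cast; linarith) n).1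
end

section
/- Let n ≥ 3. A subset S ⊆ {x_2,…,x_n} is the set of depth-one leaves of some DFS tree of size n (i.e., the set of vertices p with d_T(p) = 1 and h(T_p) = 0) if and only if the following three conditions hold: (a) if x_3 ∈ S then x_2 ∈ S; (b) if x_{n−1} ∈ S then x_n ∈ S; (c) for all i with 2 ≤ i ≤ n−2, if x_i ∈ S and x_{i+2} ∈ S then x_{i+1} ∈ S. -/
open Classical

theorem subHeight_eq_zero_iff {n : ℕ} (d : Fin n → ℕ) (p : Fin n) :
    subHeight d p = 0 ↔ ∀ h : p.1 + 1 < n, d ⟨p.1 + 1, h⟩ ≤ d p := by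
  rw [subHeight, ← Nat.bot_eq_zero, Finset.sup_eq_bot_iff]
  constructor
  · intro H h
    by_contra! hlt
    have hd : descend d p ⟨p.1 + 1, h⟩ := by
      refine ⟨Fin.le_def.2 (Nat.le_succ _), fun k hk hk' => ?_⟩
      have hk_eq : k = ⟨p.1 + 1, h⟩ :=
        Fin.ext (le_antisymm (Fin.le_def.1 hk') (Fin.lt_def.1 hk))
      rwa [hk_eq]
    have := H ⟨p.1 + 1, h⟩ (Finset.mem_univ _)
    rw [if_pos hd, Nat.bot_eq_zero] at this
    omega
  · intro H j _
    split_ifs with hd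
    · rcases hd.1.eq_or_lt with rfl | hlt
      · exact Nat.sub_self _
      · have hlt' := Fin.lt_def.1 hlt
        have hn : p.1 + 1 < n := by omega
        have := hd.2 ⟨p.1 + 1, hn⟩ (Fin.lt_def.2 (Nat.lt_succ_self _))
          (Fin.le_def.2 hlt')
        exact absurd (H hn) (by omega)
    · rfl

/-- In a DFS tree, a vertex is a depth-one leaf iff it has depth one and so does
the next vertex, if there is one. -/
theorem IsZag.depth_one_leaf_iff {n : ℕ} {d : Fin n → ℕ} (hd : IsZag n d) (p : Fin n) :
    (d p = 1 ∧ subHeight d p = 0) ↔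
      d p = 1 ∧ ∀ h : p.1 + 1 < n, d ⟨p.1 + 1, h⟩ = 1 := by
  rw [subHeight_eq_zero_iff]
  refine and_congr_right fun hp => forall_congr' fun h => ?_
  have := (hd.2 p.1 h).1
  omega

/-- for `n ≥ 3`, a set `S ⊆ {x₂, …, xₙ}` (indices shifted by one:
`x_i` is `⟨i-1, _⟩ : Fin n`) is the set of depth-one leaves of some DFS tree of
size `n` iff (a) `x₃ ∈ S → x₂ ∈ S`, (b) `x_{n-1} ∈ S → x_n ∈ S`, and (c) for
`2 ≤ i ≤ n-2`, `x_i ∈ S → x_{i+2} ∈ S → x_{i+1} ∈ S`. -/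
theorem depth_one_leaf_sets {n : ℕ} (hn : 3 ≤ n) (S : Set (Fin n))
    (hS : ∀ p ∈ S, 1 ≤ p.1) :
    (∃ d : Fin n → ℕ, IsZag n d ∧
        ∀ p : Fin n, p ∈ S ↔ (d p = 1 ∧ subHeight d p = 0)) ↔
      (((⟨2, by omega⟩ : Fin n) ∈ S → (⟨1, by omega⟩ : Fin n) ∈ S) ∧
       ((⟨n - 2, by omega⟩ : Fin n) ∈ S → (⟨n - 1, by omega⟩ : Fin n) ∈ S) ∧
       ∀ (j : ℕ) (hj : j + 2 < n), 1 ≤ j →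
         (⟨j, by omega⟩ : Fin n) ∈ S → (⟨j + 2, hj⟩ : Fin n) ∈ S →
         (⟨j + 1, by omega⟩ : Fin n) ∈ S) := by
  constructor
  · rintro ⟨d, hd, H⟩
    simp only [hd.depth_one_leaf_iff] at H
    refine ⟨fun h => ?_, fun h => ?_, fun j hj _ h h' => ?_⟩
    · have h0 := hd.1 (by omega)
      have h1 := hd.2 0 (by omega)
      simp only [zero_add] at h1
      exact (H _).2 ⟨by omega, fun _ => ((H _).1 h).1⟩
    · have h1 := ((H _).1 h).2 (by simp only; omega)
      refine (H _).2 ⟨?_, fun hlt => absurd hlt (by simp only; omega)⟩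
      have hlast : (⟨n - 1, by omega⟩ : Fin n) = ⟨n - 2 + 1, by omega⟩ :=
        Fin.ext (by simp only; omega)
      rw [hlast]
      exact h1
    · exact (H _).2 ⟨((H _).1 h).2 (by simp only; omega), fun _ => ((H _).1 h').1⟩
  · rintro ⟨ha, hb, hc⟩
    let P : ℕ → Prop := fun i => ∃ h : i < n, (⟨i, h⟩ : Fin n) ∈ S
    have hP (p : Fin n) : p ∈ S ↔ P p.1 := ⟨fun h => ⟨p.2, h⟩, fun ⟨_, h⟩ => h⟩
    have hP0 : ¬ P 0 := fun ⟨_, h⟩ => absurd (hS _ h) (by simp)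
    have hPa : P 2 → P 1 := fun ⟨_, h⟩ => ⟨_, ha h⟩
    have hPb : P (n - 2) → P (n - 1) := fun ⟨_, h⟩ => ⟨_, hb h⟩
    have hPc (j : ℕ) (hj : 1 ≤ j) : P j → P (j + 2) → P (j + 1) :=
      fun ⟨_, h⟩ ⟨h2, h'⟩ => ⟨_, hc j h2 hj h h'⟩
    let e : ℕ → ℕ := fun i => if i = 0 then 0 else if i = 1 ∨ P i ∨ P (i - 1) then 1 else 2
    have he0 : e 0 = 0 := rfl
    have he1 : e 1 = 1 := by simp [e]
    have he_succ (i : ℕ) : e (i + 1) = if i = 0 ∨ P (i + 1) ∨ P i then 1 else 2 := by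
      simp only [e, Nat.add_sub_cancel, Nat.add_eq_right, Nat.succ_ne_zero, if_false]
    have he_bounds (i : ℕ) : 1 ≤ e (i + 1) ∧ e (i + 1) ≤ 2 := by
      rw [he_succ]
      split_ifs <;> simp
    have he (i : ℕ) : e (i + 1) = 1 ↔ i = 0 ∨ P (i + 1) ∨ P i := by
      rw [he_succ]
      split_ifs with h <;> simp [h]
    have hz : IsZag n fun i => e i.1 := by
      refine ⟨fun _ => he0, fun i _ => ?_⟩
      simp only
      rcases i with _ | i
      · simp [he0, he1]
      · have h1 := he_bounds i
        have h2 := he_bounds (i + 1)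
        omega
    refine ⟨_, hz, fun p => ?_⟩
    rw [hz.depth_one_leaf_iff, hP]
    obtain ⟨p, hp⟩ := p
    simp only
    rcases p with _ | p
    · simp [hP0, he0]
    rw [he, he]
    constructor
    · exact fun h => ⟨.inr (.inl h), fun _ => .inr (.inr h)⟩
    · rintro ⟨h1, h2⟩
      by_contra hnot
      by_cases hlt : p + 1 + 1 < n
      · have hnext : P (p + 2) := by
          rcases h2 hlt with h | h | h
          · omega
          · exact h
          · exact absurd h hnot
        rcases p with _ | p
        · exact hnot (hPa hnext)
        · have hprev : P (p + 1) := by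
            rcases h1 with h | h | h
            · omega
            · exact absurd h hnot
            · exact h
          exact hnot (hPc _ (by omega) hprev hnext)
      · have hprev : P p := by
          rcases h1 with h | h | h
          · omega
          · exact absurd h hnot
          · exact h
        rw [show p = n - 2 by omega] at hprev
        have := hPb hprev
        rw [show n - 1 = p + 1 by omega] at this
        exact hnot this
end

section
/- Let n ≥ 2. A subset S ⊆ {x_2,…,x_n} is the set of depth-one vertices of some DFS tree of size n (i.e., the set of vertices p with d_T(p) = 1) if and only if x_2 ∈ S. -/
open Classical

/-- for `n ≥ 2`, a set `S ⊆ {x₂, …, xₙ}` (indices shifted by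
one: `x_i` is `⟨i-1, _⟩ : Fin n`) is the set of depth-one vertices of some DFS
tree of size `n` iff `x₂ ∈ S`. -/
theorem depth_one_vertex_sets {n : ℕ} (hn : 2 ≤ n) (S : Set (Fin n))
    (hS : ∀ p ∈ S, 1 ≤ p.1) :
    (∃ d : Fin n → ℕ, IsZag n d ∧ ∀ p : Fin n, p ∈ S ↔ d p = 1) ↔
      (⟨1, by omega⟩ : Fin n) ∈ S := by
  constructor
  · rintro ⟨d, ⟨h0, h1⟩, hd⟩
    have h := h1 0 (by omega)
    rw [h0 (by omega)] at h
    exact (hd _).2 (le_antisymm h.2 h.1)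
  · intro h1
    refine ⟨fun p => if p.1 = 0 then 0 else if p ∈ S then 1 else 2, ⟨fun _ => if_pos rfl, ?_⟩, ?_⟩
    · intro i hi
      rcases Nat.eq_zero_or_pos i with rfl | hpos
      · simp [h1]
      · simp only [Nat.succ_ne_zero, hpos.ne', if_false]
        split_ifs <;> omega
    · intro p
      by_cases hp : p.1 = 0
      · have : p ∉ S := fun h => by
          have := hS p h
          omega
        simp [hp, this]
      · by_cases hpS : p ∈ S <;> simp [hp, hpS]
end

section
/- Let n ≥ 2, and let ∼ be the equivalence relation on B_n that relates t and t' if and only if the DFS trees T = G(t) and T' = G(t') coincide up to level one, i.e., for every p ∈ {x_1,…,x_n}, d_T(p) = 1 if and only if d_{T'}(p) = 1. Then the number of equivalence classes of ∼ is exactly 2^{n−2}. -/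
open Classical

/-- The indicator word of the vertices of depth one in `G(t)`. -/
def Bracketing.levelOneWord {n : ℕ} (t : Bracketing n) : List Bool :=
  t.depthList.map (· == 1)

theorem Bracketing.length_levelOneWord {n : ℕ} (t : Bracketing n) :
    t.levelOneWord.length = n := by
  simp [Bracketing.levelOneWord, t.length_depthList]

theorem Bracketing.levelOneWord_eq_iff {n : ℕ} (t t' : Bracketing n) :
    t.levelOneWord = t'.levelOneWord ↔ ∀ p : Fin n, t.depth p = 1 ↔ t'.depth p = 1 := by
  constructor
  · intro h p
    have hp := congrArg (fun w : List Bool => w[(p : ℕ)]?) h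
    have h₁ : (p : ℕ) < t.depthList.length := by rw [t.length_depthList]; exact p.2
    have h₂ : (p : ℕ) < t'.depthList.length := by rw [t'.length_depthList]; exact p.2
    simp only [Bracketing.levelOneWord, List.getElem?_map, List.getElem?_eq_getElem h₁,
      List.getElem?_eq_getElem h₂, Option.map_some, Option.some.injEq] at hp
    rw [Bool.eq_iff_iff] at hp
    simpa [Bracketing.depth] using hp
  · intro h
    refine List.ext_getElem (by simp [Bracketing.length_levelOneWord]) fun i h₁ h₂ => ?_
    have hi : i < n := by rwa [t.length_levelOneWord] at h₁
    rw [Bool.eq_iff_iff]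
    simpa [Bracketing.levelOneWord, Bracketing.depth] using h ⟨i, hi⟩

theorem Bracketing.depthList_eq_singleton_or_cons_cons {n : ℕ} (t : Bracketing n) :
    t.depthList = [0] ∨ ∃ ds, t.depthList = 0 :: 1 :: ds := by
  induction t with
  | leaf => exact Or.inl rfl
  | node l r ihl ihr =>
    right
    rcases ihl with hl | ⟨ds, hl⟩
    · rcases ihr with hr | ⟨es, hr⟩ <;> simp [Bracketing.depthList, hl, hr]
    · simp [Bracketing.depthList, hl]

theorem Bracketing.exists_levelOneWord_eq {n : ℕ} (hn : 2 ≤ n) (t : Bracketing n) :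
    ∃ w, t.levelOneWord = false :: true :: w := by
  rcases t.depthList_eq_singleton_or_cons_cons with h | ⟨ds, h⟩
  · have := t.length_depthList
    simp [h] at this
    omega
  · exact ⟨ds.map (· == 1), by simp [Bracketing.levelOneWord, h]⟩

/-- Appending a vertex at depth one or two to `G(t)` extends the word by an arbitrary letter. -/
theorem Bracketing.exists_node_levelOneWord_eq (w : List Bool) :
    ∃ (m k : ℕ) (l : Bracketing m) (r : Bracketing k),
      (Bracketing.node l r).levelOneWord = false :: true :: w := by
  induction w using List.reverseRecOn with
  | nil => exact ⟨1, 1, .leaf, .leaf, by simp [Bracketing.levelOneWord, Bracketing.depthList]⟩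
  | append_singleton w b ih =>
    obtain ⟨m, k, l, r, h⟩ := ih
    cases b with
    | true =>
      refine ⟨m + k, 1, .node l r, .leaf, ?_⟩
      rw [← List.cons_append, ← List.cons_append, ← h]
      simp [Bracketing.levelOneWord, Bracketing.depthList]
    | false =>
      refine ⟨m, k + 1, l, .node r .leaf, ?_⟩
      rw [← List.cons_append, ← List.cons_append, ← h]
      simp [Bracketing.levelOneWord, Bracketing.depthList]

theorem Bracketing.exists_levelOneWord_eq_of_length {n : ℕ} (w : List Bool)
    (hw : w.length + 2 = n) : ∃ t : Bracketing n, t.levelOneWord = false :: true :: w := by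
  obtain ⟨m, k, l, r, h⟩ := Bracketing.exists_node_levelOneWord_eq w
  have hlen : m + k = n := by
    rw [← (Bracketing.node l r).length_levelOneWord, h, ← hw]
    rfl
  subst hlen
  exact ⟨_, h⟩

/-- Lemma 9.5: for `n ≥ 2`, the equivalence relation on `B_n`
relating `t` and `t'` iff the DFS trees `G(t)` and `G(t')` coincide up to level
one has exactly `2 ^ (n - 2)` equivalence classes. -/
theorem card_level_one_classes (n : ℕ) (hn : 2 ≤ n) :
    Nat.card
      (Quot fun t t' : Bracketing n => ∀ p : Fin n, t.depth p = 1 ↔ t'.depth p = 1) =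
      2 ^ (n - 2) := by
  let f : (Quot fun t t' : Bracketing n => ∀ p : Fin n, t.depth p = 1 ↔ t'.depth p = 1) →
      List.Vector Bool (n - 2) :=
    Quot.lift (fun t => ⟨t.levelOneWord.drop 2, by simp [t.length_levelOneWord]⟩)
      fun t t' h => Subtype.ext (congrArg (List.drop 2) ((t.levelOneWord_eq_iff t').2 h))
  have hf : Function.Bijective f := by
    constructor
    · rintro ⟨t⟩ ⟨t'⟩ h
      obtain ⟨w, hw⟩ := t.exists_levelOneWord_eq hn
      obtain ⟨w', hw'⟩ := t'.exists_levelOneWord_eq hn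
      have h' : t.levelOneWord.drop 2 = t'.levelOneWord.drop 2 := congrArg Subtype.val h
      refine Quot.sound ((t.levelOneWord_eq_iff t').1 ?_)
      simpa [hw, hw'] using h'
    · rintro ⟨w, hw⟩
      obtain ⟨t, ht⟩ :=
        Bracketing.exists_levelOneWord_eq_of_length (n := n) w (by omega)
      exact ⟨Quot.mk _ t, Subtype.ext (by simp [f, ht])⟩
  rw [Nat.card_congr (Equiv.ofBijective f hf), Nat.card_eq_fintype_card, card_vector,
    Fintype.card_bool]
end
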